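/- arXiv:1206.1847 — 3 statements merged into one kernel-verified Lean document; each statement's English description precedes it below -/
import Mathlib

section
/- For every N ≥ 1, all distinct α, β ∈ {x, y, z}, and all ℓ, m ∈ ℕ, the mixed trace with an odd power vanishes: tr((Ŝ_α^{(N)})^{2ℓ+1} (Ŝ_β^{(N)})^m) = 0. -/
open Matrix Filter Topology MeasureTheory

/-- The spin-1/2 matrices: `spinMat 0 = s_x`, `spinMat 1 = s_y`, `spinMat 2 = s_z`. -/
noncomputable def spinMat : Fin 3 → Matrix (Fin 2) (Fin 2) ℂ
  | 0 => !![0, 1/2; 1/2, 0]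
  | 1 => !![0, -Complex.I/2; Complex.I/2, 0]
  | 2 => !![1/2, 0; 0, -1/2]

/-- The `N`-fold Kronecker (tensor) product of `2 × 2` matrices, realized on the
index type `Fin N → Fin 2` of cardinality `2^N`. -/
noncomputable def kronPow (N : ℕ) (A : Fin N → Matrix (Fin 2) (Fin 2) ℂ) :
    Matrix (Fin N → Fin 2) (Fin N → Fin 2) ℂ :=
  Matrix.of fun f g => ∏ k, A k (f k) (g k)

/-- The total spin operator `Ŝ_α^{(N)} = Σ_{j=1}^N I₂^{⊗(j-1)} ⊗ s_α ⊗ I₂^{⊗(N-j)}`. -/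
noncomputable def totalSpin (N : ℕ) (α : Fin 3) :
    Matrix (Fin N → Fin 2) (Fin N → Fin 2) ℂ :=
  ∑ j : Fin N, kronPow N (fun k => if k = j then spinMat α else 1)

theorem kronPow_mul_aux (N : ℕ) (A B : Fin N → Matrix (Fin 2) (Fin 2) ℂ) :
    kronPow N A * kronPow N B = kronPow N (fun k => A k * B k) := by
  ext f g
  simp only [kronPow, Matrix.mul_apply, Matrix.of_apply]
  rw [Finset.prod_univ_sum, Fintype.piFinset_univ]
  simp only [Finset.prod_mul_distrib]

theorem kronPow_one_aux (N : ℕ) : kronPow N (fun _ => 1) = 1 := by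
  ext f g
  simp only [kronPow, Matrix.of_apply, Matrix.one_apply]
  rw [Finset.prod_ite_zero]
  simp [funext_iff]

theorem semiconj_totalSpin_aux (N : ℕ) (P : Matrix (Fin 2) (Fin 2) ℂ) (c : ℂ) (α : Fin 3)
    (h : P * spinMat α = c • (spinMat α * P)) :
    SemiconjBy (kronPow N (fun _ => P)) (totalSpin N α) (c • totalSpin N α) := by
  unfold SemiconjBy totalSpin
  rw [Finset.mul_sum, Matrix.smul_mul, Finset.sum_mul, Finset.smul_sum]
  refine Finset.sum_congr rfl fun j _ => ?_
  rw [kronPow_mul_aux, kronPow_mul_aux]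
  ext f g
  simp only [kronPow, Matrix.of_apply, Matrix.smul_apply, smul_eq_mul]
  have hc : c = ∏ k : Fin N, if k = j then c else 1 := by simp
  rw [hc, ← Finset.prod_mul_distrib]
  refine Finset.prod_congr rfl fun k _ => ?_
  by_cases hk : k = j
  · simp only [hk, if_true, h, Matrix.smul_apply, smul_eq_mul]
  · simp [hk]

theorem spin_sq_aux (β : Fin 3) : ((2 : ℂ) • spinMat β) * ((2 : ℂ) • spinMat β) = 1 := by
  fin_cases β <;> ext i j <;> fin_cases i <;> fin_cases j <;>
    simp [spinMat, Matrix.mul_apply] <;> ring_nf <;> simp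

theorem spin_anti_aux (α β : Fin 3) (h : α ≠ β) :
    spinMat β * spinMat α = (-1 : ℂ) • (spinMat α * spinMat β) := by
  fin_cases α <;> fin_cases β <;> first
    | exact absurd rfl h
    | (ext i j; fin_cases i <;> fin_cases j <;> simp [spinMat, Matrix.mul_apply] <;> ring_nf)

/-- for every `N ≥ 1`, all distinct `α, β ∈ {x,y,z}` and all `ℓ, m ∈ ℕ`,
`tr((Ŝ_α^{(N)})^{2ℓ+1} (Ŝ_β^{(N)})^m) = 0`. -/
theorem trace_odd_mixed_power_totalSpin_eq_zero (N : ℕ) (hN : 1 ≤ N)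
    (α β : Fin 3) (hαβ : α ≠ β) (ℓ m : ℕ) :
    (totalSpin N α ^ (2 * ℓ + 1) * totalSpin N β ^ m).trace = 0 := by
  set P : Matrix (Fin 2) (Fin 2) ℂ := (2 : ℂ) • spinMat β with hP
  have hU : kronPow N (fun _ => P) * kronPow N (fun _ => P) = 1 := by
    rw [kronPow_mul_aux, hP, spin_sq_aux, kronPow_one_aux]
  have h1 : SemiconjBy (kronPow N (fun _ => P)) (totalSpin N α) ((-1 : ℂ) • totalSpin N α) := by
    apply semiconj_totalSpin_aux
    rw [hP, Matrix.smul_mul, Matrix.mul_smul, spin_anti_aux α β hαβ, smul_comm]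
  have h2 : SemiconjBy (kronPow N (fun _ => P)) (totalSpin N β) ((1 : ℂ) • totalSpin N β) := by
    apply semiconj_totalSpin_aux
    rw [hP, Matrix.smul_mul, Matrix.mul_smul, one_smul]
  have h3 := (h1.pow_right (2 * ℓ + 1)).mul_right (h2.pow_right m)
  rw [one_smul, neg_one_smul, Odd.neg_pow ⟨ℓ, rfl⟩, Matrix.neg_mul] at h3
  generalize totalSpin N α ^ (2 * ℓ + 1) * totalSpin N β ^ m = X at h3 ⊢
  generalize kronPow N (fun _ => P) = U at h3 hU
  have h4 : X.trace = -X.trace := by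
    calc X.trace = (U * (U * X)).trace := by rw [← Matrix.mul_assoc, hU, Matrix.one_mul]
      _ = ((U * X) * U).trace := Matrix.trace_mul_comm _ _
      _ = -X.trace := by
        rw [h3.eq, Matrix.mul_assoc, hU, Matrix.mul_one, Matrix.trace_neg]
  exact self_eq_neg.mp h4
end

section
/- For all distinct α, β ∈ {x, y, z} and all m, ℓ ∈ ℕ, lim_{N→∞} 2^{-N} N^{-(m+ℓ)/2} tr((Ŝ_α^{(N)})^m (Ŝ_β^{(N)})^ℓ) = (2/π) ∬_{ℝ²} η^m μ^ℓ e^{-2(η² + μ²)} dη dμ; i.e., in the large N limit the two scaled spin components behave like two independent centered Gaussian variables of variance 1/4 with respect to the normalized trace. -/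
open Matrix Filter Topology MeasureTheory

noncomputable def gI (m : ℕ) : ℝ := ∫ x : ℝ, x ^ m * Real.exp (-2 * x ^ 2)

lemma gI_integrable (m : ℕ) : Integrable (fun x : ℝ => x ^ m * Real.exp (-2 * x ^ 2)) := by
  have h := integrable_rpow_mul_exp_neg_mul_sq (b := 2) (by norm_num) (s := m)
    (by have : (0:ℝ) ≤ m := Nat.cast_nonneg m
        linarith)
  simpa [Real.rpow_natCast] using h

lemma gI_succ (m : ℕ) : gI (m + 2) = (m + 1) / 4 * gI m := by
  have hd : ∀ x : ℝ, HasDerivAt (fun x : ℝ => x ^ (m+1) * Real.exp (-2 * x ^ 2))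
      ((m+1) * (x ^ m * Real.exp (-2 * x ^ 2)) - 4 * (x ^ (m+2) * Real.exp (-2 * x ^ 2))) x := by
    intro x
    have h1 := hasDerivAt_pow (m+1) x
    have h2 := (((hasDerivAt_pow 2 x).const_mul (-2)).exp)
    have h3 := h1.mul h2
    refine h3.congr_deriv ?_
    push_cast
    ring
  have i1 := (gI_integrable m).const_mul ((m:ℝ)+1)
  have i2 := (gI_integrable (m+2)).const_mul (4:ℝ)
  have h := integral_eq_zero_of_hasDerivAt_of_integrable hd (i1.sub i2) (gI_integrable (m+1))
  rw [integral_sub i1 i2, integral_const_mul, integral_const_mul] at h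
  unfold gI
  linarith

lemma gI_zero : gI 0 = Real.sqrt (Real.pi / 2) := by
  unfold gI; simpa using integral_gaussian 2

lemma gI_one : gI 1 = 0 := by
  have hd : ∀ x : ℝ, HasDerivAt (fun x : ℝ => x ^ 0 * Real.exp (-2 * x ^ 2))
      (-4 * (x ^ 1 * Real.exp (-2 * x ^ 2))) x := by
    intro x
    have h1 := hasDerivAt_pow 0 x
    have h2 := (((hasDerivAt_pow 2 x).const_mul (-2)).exp)
    have h3 := h1.mul h2
    refine h3.congr_deriv ?_
    push_cast
    ring
  have i1 := (gI_integrable 1).const_mul (-4:ℝ)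
  have h := integral_eq_zero_of_hasDerivAt_of_integrable hd i1 (gI_integrable 0)
  rw [integral_const_mul] at h
  unfold gI
  linarith

lemma gI_prod (m l : ℕ) :
    ∫ p : ℝ × ℝ, p.1 ^ m * p.2 ^ l * Real.exp (-2 * (p.1 ^ 2 + p.2 ^ 2)) = gI m * gI l := by
  unfold gI
  rw [← integral_prod_mul]
  congr 1; ext p
  rw [mul_add, Real.exp_add]; ring

/-- normalized Gaussian moments over factorial -/
noncomputable def gB (m : ℕ) : ℝ := gI m / Real.sqrt (Real.pi / 2) / m.factorial

lemma gB_zero : gB 0 = 1 := by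
  have : Real.sqrt (Real.pi / 2) ≠ 0 := by positivity
  simp only [gB, gI_zero, Nat.factorial_zero, Nat.cast_one, div_one]; exact div_self this

lemma gB_one : gB 1 = 0 := by simp [gB, gI_one]

lemma gB_succ (m : ℕ) : gB (m + 2) = gB m / (4 * (m + 2)) := by
  have : Real.sqrt (Real.pi / 2) ≠ 0 := by positivity
  have h2 : (m.factorial : ℝ) ≠ 0 := by positivity
  have h3 : ((m:ℝ) + 1) ≠ 0 := by positivity
  have h4 : ((m:ℝ) + 2) ≠ 0 := by positivity
  simp only [gB, gI_succ, Nat.factorial_succ]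
  push_cast
  field_simp
  ring

/-- coefficients of cosh(X/2) -/
noncomputable def cF (i : ℕ) : ℝ := (if Even i then (1/2)^i else 0) / i.factorial
noncomputable def pF : PowerSeries ℝ := PowerSeries.mk cF
noncomputable def aC (N m : ℕ) : ℝ := PowerSeries.coeff m (pF ^ N)

lemma aC_zero (m : ℕ) : aC 0 m = if m = 0 then 1 else 0 := by
  simp [aC, PowerSeries.coeff_one]

lemma aC_succ (N m : ℕ) : aC (N+1) m = ∑ p ∈ Finset.HasAntidiagonal.antidiagonal m, cF p.1 * aC N p.2 := by
  simp [aC, pow_succ', PowerSeries.coeff_mul, pF]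

lemma aC_zero_right (N : ℕ) : aC N 0 = 1 := by
  induction N with
  | zero => simp [aC_zero]
  | succ N ih => simp [aC_succ, ih, cF]

lemma aC_deriv (N m : ℕ) : aC (N+1) (m+1) * (m+1) =
    (N+1) * ∑ p ∈ Finset.HasAntidiagonal.antidiagonal m, aC N p.1 * (cF (p.2+1) * (p.2+1)) := by
  have h : PowerSeries.coeff m (PowerSeries.derivative ℝ (pF ^ (N+1))) =
      PowerSeries.coeff m ((N+1) • (pF ^ N * PowerSeries.derivative ℝ pF)) := by
    rw [Derivation.leibniz_pow]; rfl
  rw [PowerSeries.coeff_derivative, map_nsmul, PowerSeries.coeff_mul] at h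
  simp only [PowerSeries.coeff_derivative] at h
  have hp : ∀ i, PowerSeries.coeff i pF = cF i := fun i => by simp [pF]
  simp only [hp, nsmul_eq_mul, Nat.cast_add, Nat.cast_one] at h
  exact h

lemma ratio_tendsto : Tendsto (fun N : ℕ => √(N:ℝ) / √((N:ℝ)+1)) atTop (𝓝 1) := by
  have h : Tendsto (fun N : ℕ => (N:ℝ) / ((N:ℝ)+1)) atTop (𝓝 1) := tendsto_natCast_div_add_atTop 1
  have h2 := h.sqrt
  simpa [Real.sqrt_div] using h2

lemma inv_tendsto : Tendsto (fun N : ℕ => (√((N:ℝ)+1))⁻¹) atTop (𝓝 0) := by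
  apply Tendsto.inv_tendsto_atTop
  apply Real.tendsto_sqrt_atTop.comp
  exact tendsto_atTop_add_const_right _ _ tendsto_natCast_atTop_atTop

lemma term_tendsto (i j : ℕ) (g : ℝ)
    (h : Tendsto (fun N : ℕ => aC N i / √(N:ℝ) ^ i) atTop (𝓝 g)) :
    Tendsto (fun N : ℕ => ((N:ℝ)+1) * (aC N i * (cF (j+1) * (j+1))) / √((N:ℝ)+1) ^ (i+j+1))
      atTop (𝓝 (if j = 1 then g / 4 else 0)) := by
  rcases j with _ | k
  · simp [cF]
  have h1 := ((h.mul (ratio_tendsto.pow i)).mul (inv_tendsto.pow k)).mul_const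
    (cF (k+1+1) * ((k:ℝ)+1+1))
  have e : g * 1 ^ i * 0 ^ k * (cF (k+1+1) * ((k:ℝ)+1+1)) = if k + 1 = 1 then g / 4 else 0 := by
    rcases k with _ | k
    · simp [cF]; ring
    · simp
  rw [e] at h1
  refine h1.congr' ?_
  filter_upwards [eventually_ge_atTop 1] with N hN
  have p1 : (0:ℝ) < N := by exact_mod_cast hN
  have p2 : √(N:ℝ) ≠ 0 := by positivity
  have p3 : √((N:ℝ)+1) ≠ 0 := by positivity
  have p4 : ((N:ℝ)+1) = √((N:ℝ)+1)^2 := by rw [Real.sq_sqrt (by positivity)]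
  set s := √((N:ℝ)+1) with hs
  rw [p4]
  push_cast
  rw [div_pow, inv_pow, show i + (k+1) + 1 = i + k + 2 by ring, pow_add, pow_add]
  field_simp

lemma aC_tendsto (m : ℕ) : Tendsto (fun N : ℕ => aC N m / √(N:ℝ) ^ m) atTop (𝓝 (gB m)) := by
  induction m using Nat.strong_induction_on with
  | _ m ih =>
  rcases m with _ | m
  · simp [aC_zero_right, gB_zero]
  rw [← tendsto_add_atTop_iff_nat 1]
  have h := tendsto_finsetSum (Finset.HasAntidiagonal.antidiagonal m) (fun p hp =>
    term_tendsto p.1 p.2 (gB p.1) (ih p.1 (by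
      have := Finset.HasAntidiagonal.mem_antidiagonal.1 hp; omega)))
  have h2 := h.div_const ((m:ℝ)+1)
  have e : (∑ p ∈ Finset.HasAntidiagonal.antidiagonal m, if p.2 = 1 then gB p.1 / 4 else 0) / ((m:ℝ)+1)
      = gB (m+1) := by
    rcases m with _ | m
    · simp [gB_one]
    · rw [Finset.sum_eq_single (m, 1)]
      · rw [gB_succ]; push_cast; rw [div_div]; ring
      · rintro ⟨a, b⟩ hp hne
        rw [Finset.HasAntidiagonal.mem_antidiagonal] at hp
        rw [if_neg]
        rintro h; apply hne; simp at h hp ⊢; omega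
      · simp
  rw [e] at h2
  refine h2.congr ?_
  intro N
  have := aC_deriv N m
  have hm : (m:ℝ)+1 ≠ 0 := by positivity
  have : aC (N+1) (m+1) = ((N+1) * ∑ p ∈ Finset.HasAntidiagonal.antidiagonal m, aC N p.1 * (cF (p.2+1) * (p.2+1))) / (m+1) := by
    rw [← this]; field_simp
  rw [this, Finset.mul_sum, div_right_comm, Finset.sum_div _ _ (√_ ^ _)]
  congr 1
  apply Finset.sum_congr rfl
  rintro ⟨a, b⟩ hp
  rw [Finset.HasAntidiagonal.mem_antidiagonal] at hp
  simp at hp ⊢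
  rw [hp]

lemma spin_sq (α : Fin 3) : spinMat α ^ 2 = (1/4 : ℂ) • 1 := by
  fin_cases α <;> ext i j <;> fin_cases i <;> fin_cases j <;>
    simp [spinMat, pow_two, Matrix.mul_apply, Fin.sum_univ_two] <;> ring_nf <;> simp <;> norm_num

lemma spin_tr (α : Fin 3) : (spinMat α).trace = 0 := by
  fin_cases α <;> simp [spinMat, Matrix.trace, Fin.sum_univ_two] <;> ring

lemma spin_tr2 (α β : Fin 3) (h : α ≠ β) : (spinMat α * spinMat β).trace = 0 := by
  fin_cases α <;> fin_cases β <;> first | exact absurd rfl h |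
    (simp [spinMat, Matrix.trace, Fin.sum_univ_two, Matrix.mul_apply] <;> ring)

lemma spin_even (α : Fin 3) (k : ℕ) : spinMat α ^ (k + k) = ((1/2 : ℂ)^(k+k)) • 1 := by
  rw [← two_mul, pow_mul, spin_sq, smul_pow, one_pow, pow_mul]; norm_num

lemma spin_trace_pow (α β : Fin 3) (h : α ≠ β) (i j : ℕ) :
    (spinMat α ^ i * spinMat β ^ j).trace =
      2 * ((cF i * i.factorial : ℝ) : ℂ) * ((cF j * j.factorial : ℝ) : ℂ) := by
  have hc : ∀ i, cF i * i.factorial = if Even i then (1/2)^i else 0 := by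
    intro i
    have : (i.factorial : ℝ) ≠ 0 := by positivity
    unfold cF; field_simp
  rw [hc, hc]
  rcases Nat.even_or_odd i with hi | hi <;> rcases Nat.even_or_odd j with hj | hj
  · rw [if_pos hi, if_pos hj]
    obtain ⟨k, rfl⟩ := hi
    obtain ⟨l, rfl⟩ := hj
    rw [spin_even, spin_even]
    simp [Matrix.trace_smul]; ring
  · rw [if_neg (Nat.not_even_iff_odd.2 hj)]
    obtain ⟨k, rfl⟩ := hi
    obtain ⟨l, rfl⟩ := hj
    rw [pow_succ, two_mul, spin_even, spin_even]
    simp [Matrix.trace_smul, spin_tr]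
  · rw [if_neg (Nat.not_even_iff_odd.2 hi)]
    obtain ⟨k, rfl⟩ := hi
    obtain ⟨l, rfl⟩ := hj
    rw [pow_succ, two_mul, spin_even, spin_even]
    simp [Matrix.trace_smul, spin_tr]
  · rw [if_neg (Nat.not_even_iff_odd.2 hi)]
    obtain ⟨k, rfl⟩ := hi
    obtain ⟨l, rfl⟩ := hj
    rw [pow_succ, pow_succ, two_mul, two_mul, spin_even, spin_even]
    simp [Matrix.trace_smul, spin_tr2 α β h]

open Kronecker

lemma kron_pow {n p : Type*} [Fintype n] [Fintype p] [DecidableEq n] [DecidableEq p]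
    (A : Matrix n n ℂ) (B : Matrix p p ℂ) (i : ℕ) : (A ⊗ₖ B) ^ i = (A ^ i) ⊗ₖ (B ^ i) := by
  induction i with
  | zero => simp
  | succ i ih => rw [pow_succ, ih, pow_succ, pow_succ, Matrix.mul_kronecker_mul]

lemma kron_add_pow {n p : Type*} [Fintype n] [Fintype p] [DecidableEq n] [DecidableEq p]
    (A : Matrix n n ℂ) (B : Matrix p p ℂ) (m : ℕ) :
    (A ⊗ₖ (1 : Matrix p p ℂ) + (1 : Matrix n n ℂ) ⊗ₖ B) ^ m =
      ∑ q ∈ Finset.HasAntidiagonal.antidiagonal m, m.choose q.1 • ((A ^ q.1) ⊗ₖ (B ^ q.2)) := by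
  have hc : Commute (A ⊗ₖ (1 : Matrix p p ℂ)) ((1 : Matrix n n ℂ) ⊗ₖ B) := by
    unfold Commute SemiconjBy
    rw [← Matrix.mul_kronecker_mul, ← Matrix.mul_kronecker_mul]; simp
  rw [hc.add_pow']
  apply Finset.sum_congr rfl
  intro q _
  rw [kron_pow, kron_pow, ← Matrix.mul_kronecker_mul]; simp

lemma totalSpin_succ (N : ℕ) (α : Fin 3) :
    Matrix.reindexAlgEquiv ℂ ℂ (Fin.consEquiv (fun _ : Fin (N+1) => Fin 2)).symm (totalSpin (N+1) α) =
      spinMat α ⊗ₖ (1 : Matrix (Fin N → Fin 2) (Fin N → Fin 2) ℂ) +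
      (1 : Matrix (Fin 2) (Fin 2) ℂ) ⊗ₖ totalSpin N α := by
  have hone : ∀ f g : Fin N → Fin 2,
      (1 : Matrix (Fin N → Fin 2) (Fin N → Fin 2) ℂ) f g =
        ∏ k, (1 : Matrix (Fin 2) (Fin 2) ℂ) (f k) (g k) := by
    intro f g
    simp only [Matrix.one_apply]
    by_cases h : f = g
    · simp [h]
    · rw [if_neg h]
      obtain ⟨k, hk⟩ := Function.ne_iff.1 h
      exact (Finset.prod_eq_zero (Finset.mem_univ k) (if_neg hk)).symm
  ext ⟨a, f⟩ ⟨b, g⟩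
  simp only [Matrix.coe_reindexAlgEquiv, Matrix.reindex_apply, Matrix.submatrix_apply,
    Equiv.symm_symm, Matrix.add_apply, Matrix.kroneckerMap_apply, totalSpin, Matrix.sum_apply,
    kronPow, Matrix.of_apply, Fin.consEquiv, Equiv.coe_fn_mk, Fin.sum_univ_succ,
    Fin.prod_univ_succ, Fin.cons_zero, Fin.cons_succ, Fin.succ_ne_zero, if_true, if_false,
    Fin.succ_inj, hone, Finset.mul_sum]
  congr 1

lemma trace_reindex_alg {n p : Type*} [Fintype n] [Fintype p] [DecidableEq n] [DecidableEq p]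
    (e : n ≃ p) (A : Matrix n n ℂ) : (Matrix.reindexAlgEquiv ℂ ℂ e A).trace = A.trace := by
  simp only [Matrix.trace, Matrix.coe_reindexAlgEquiv, Matrix.reindex_apply, Matrix.diag_apply,
    Matrix.submatrix_apply]
  exact Equiv.sum_comp e.symm (fun i => A i i)

lemma trace_succ (N : ℕ) (α β : Fin 3) (m l : ℕ) :
    (totalSpin (N+1) α ^ m * totalSpin (N+1) β ^ l).trace =
      ∑ p ∈ Finset.HasAntidiagonal.antidiagonal m, ∑ q ∈ Finset.HasAntidiagonal.antidiagonal l,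
        (m.choose p.1 : ℂ) * (l.choose q.1 : ℂ) * ((spinMat α ^ p.1 * spinMat β ^ q.1).trace *
          (totalSpin N α ^ p.2 * totalSpin N β ^ q.2).trace) := by
  rw [← trace_reindex_alg (Fin.consEquiv (fun _ : Fin (N+1) => Fin 2)).symm, map_mul, map_pow,
    map_pow, totalSpin_succ, totalSpin_succ, kron_add_pow, kron_add_pow, Finset.sum_mul_sum,
    Matrix.trace_sum]
  apply Finset.sum_congr rfl; intro p _
  rw [Matrix.trace_sum]
  apply Finset.sum_congr rfl; intro q _
  rw [smul_mul_smul_comm, ← Matrix.mul_kronecker_mul, Matrix.trace_smul, Matrix.trace_kronecker]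
  simp

lemma trace_eq (α β : Fin 3) (h : α ≠ β) (N m l : ℕ) :
    (totalSpin N α ^ m * totalSpin N β ^ l).trace =
      2 ^ N * ((m.factorial * l.factorial * (aC N m * aC N l) : ℝ) : ℂ) := by
  induction N generalizing m l with
  | zero =>
    have hz : ∀ α, totalSpin 0 α = 0 := fun α => by simp [totalSpin]
    rw [hz, hz, aC_zero, aC_zero]
    rcases m with _ | m <;> rcases l with _ | l <;> simp
  | succ N ih =>
    rw [trace_succ, aC_succ, aC_succ, Finset.sum_mul_sum]
    push_cast
    rw [Finset.mul_sum, Finset.mul_sum]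
    apply Finset.sum_congr rfl
    rintro ⟨i, j⟩ hp
    rw [Finset.mul_sum, Finset.mul_sum]
    apply Finset.sum_congr rfl
    rintro ⟨i', j'⟩ hp'
    rw [Finset.HasAntidiagonal.mem_antidiagonal] at hp hp'
    simp only at hp hp' ⊢
    subst hp hp'
    rw [spin_trace_pow α β h, ih]
    have e1 : (((i+j).factorial : ℕ) : ℂ) = (i+j).choose i * i.factorial * j.factorial := by
      rw [← Nat.add_choose_mul_factorial_mul_factorial i j, Nat.choose_symm_add]; push_cast; rfl
    have e2 : (((i'+j').factorial : ℕ) : ℂ) = (i'+j').choose i' * i'.factorial * j'.factorial := by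
      rw [← Nat.add_choose_mul_factorial_mul_factorial i' j', Nat.choose_symm_add]; push_cast; rfl
    rw [e1, e2]
    push_cast
    ring

/-- for all distinct `α, β ∈ {x,y,z}` and all `m, ℓ ∈ ℕ`,
`lim_{N→∞} 2^{-N} N^{-(m+ℓ)/2} tr((Ŝ_α^{(N)})^m (Ŝ_β^{(N)})^ℓ)
  = (2/π) ∬ η^m μ^ℓ e^{-2(η²+μ²)} dη dμ`:
the two scaled spin components behave like two independent centered Gaussians of
variance 1/4 with respect to the normalized trace. -/
theorem tendsto_trace_mixed_power_totalSpin_gaussian (α β : Fin 3) (hαβ : α ≠ β) (m ℓ : ℕ) :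
    Tendsto (fun N : ℕ =>
        (totalSpin N α ^ m * totalSpin N β ^ ℓ).trace /
          (2 ^ N * ((Real.sqrt N : ℂ)) ^ (m + ℓ)))
      atTop
      (𝓝 ((2 / Real.pi *
        ∫ p : ℝ × ℝ, p.1 ^ m * p.2 ^ ℓ * Real.exp (-2 * (p.1 ^ 2 + p.2 ^ 2)) : ℝ) : ℂ)) := by
  have h := ((aC_tendsto m).mul (aC_tendsto ℓ)).const_mul ((m.factorial : ℝ) * ℓ.factorial)
  have e : (m.factorial : ℝ) * ℓ.factorial * (gB m * gB ℓ) = 2 / Real.pi *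
        ∫ p : ℝ × ℝ, p.1 ^ m * p.2 ^ ℓ * Real.exp (-2 * (p.1 ^ 2 + p.2 ^ 2)) := by
    rw [gI_prod]
    have h1 : (m.factorial : ℝ) ≠ 0 := by positivity
    have h2 : (ℓ.factorial : ℝ) ≠ 0 := by positivity
    have h3 : √(Real.pi / 2) ≠ 0 := by positivity
    have h4 : 2 / Real.pi = 1 / (√(Real.pi / 2) * √(Real.pi / 2)) := by
      rw [Real.mul_self_sqrt (by positivity), one_div_div]
    rw [h4]
    unfold gB
    generalize √(Real.pi / 2) = s at *
    field_simp
  rw [e] at h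
  have h' := (Complex.continuous_ofReal.tendsto _).comp h
  refine h'.congr ?_
  intro N
  rw [trace_eq α β hαβ]
  have : (2:ℂ) ^ N ≠ 0 := pow_ne_zero _ two_ne_zero
  rw [mul_div_mul_left _ _ this]
  simp only [Function.comp]
  push_cast
  rw [pow_add, mul_div_assoc, mul_div_mul_comm]
end

section
/- (Monomial form of the main bosonization theorem.) For all m, n ∈ ℕ, lim_{N→∞} 2^{-N} N^{-(m+n)/2} tr((Ŝ_+^{(N)})^m (Ŝ_-^{(N)})^n) = (2/√3) Σ_{k=0}^{∞} e^{-ln 3 · (k+1/2)} · c_{m,n,k}, where c_{m,n,k} = δ_{mn} · k!/(k−n)! if k ≥ n and c_{m,n,k} = 0 otherwise (these are the number-basis diagonal matrix elements ⟨k| (a†)^m a^n |k⟩ of the normal-ordered monomial); both sides equal δ_{mn} · n!/2^n. -/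
open Matrix Filter Topology MeasureTheory

/-- The total raising operator `Ŝ_+^{(N)} = Ŝ_x^{(N)} + i Ŝ_y^{(N)}`. -/
noncomputable def totalSpinPlus (N : ℕ) : Matrix (Fin N → Fin 2) (Fin N → Fin 2) ℂ :=
  totalSpin N 0 + Complex.I • totalSpin N 1

/-- The total lowering operator `Ŝ_-^{(N)} = Ŝ_x^{(N)} - i Ŝ_y^{(N)}`. -/
noncomputable def totalSpinMinus (N : ℕ) : Matrix (Fin N → Fin 2) (Fin N → Fin 2) ℂ :=
  totalSpin N 0 - Complex.I • totalSpin N 1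

/-- The number-basis diagonal matrix elements `⟨k|(a†)^m a^n|k⟩` of the normal-ordered
monomial: `δ_{mn} k!/(k−n)!` if `k ≥ n`, and `0` otherwise. -/
noncomputable def bosonMatrixElem (m n k : ℕ) : ℝ :=
  if n ≤ k then (if m = n then (Nat.factorial k : ℝ) / (Nat.factorial (k - n) : ℝ) else 0)
  else 0

open Polynomial in
/-- One-site generating matrix. -/
noncomputable def genMat (a b : Fin 2) : Polynomial ℂ :=
  if a = b then 1 else if a = 0 then X else 0

open Polynomial in
/-- The generating polynomial of the matrix elements of powers of the raising operator. -/
noncomputable def genPoly (N : ℕ) (f g : Fin N → Fin 2) : Polynomial ℂ :=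
  ∏ k, genMat (f k) (g k)

/-- The one-site raising matrix. -/
noncomputable def raiseMat : Matrix (Fin 2) (Fin 2) ℂ := !![0, 1; 0, 0]

lemma prod_site {N : ℕ} {R : Type*} [CommRing R] (F : Fin N → R) (G : Fin N → R) (j : Fin N) :
    (∏ k, if k = j then F k else G k) = (∏ k ∈ Finset.univ.erase j, G k) * F j := by
  rw [← Finset.prod_erase_mul _ _ (Finset.mem_univ j)]
  congr 1
  · apply Finset.prod_congr rfl
    intro k hk
    simp [Finset.ne_of_mem_erase hk]
  · simp

lemma totalSpin_apply (N : ℕ) (α : Fin 3) (f g : Fin N → Fin 2) :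
    totalSpin N α f g = ∑ j, (∏ k ∈ Finset.univ.erase j,
      (1 : Matrix (Fin 2) (Fin 2) ℂ) (f k) (g k)) * spinMat α (f j) (g j) := by
  unfold totalSpin kronPow
  rw [Matrix.sum_apply]
  apply Finset.sum_congr rfl
  intro j _
  rw [← prod_site (fun k => spinMat α (f k) (g k))]
  simp only [Matrix.of_apply]
  apply Finset.prod_congr rfl
  intro k _
  split_ifs <;> rfl

lemma raise_eq (a b : Fin 2) :
    spinMat 0 a b + Complex.I * spinMat 1 a b = raiseMat a b := by
  have h := Complex.I_mul_I
  fin_cases a <;> fin_cases b <;> simp [spinMat, raiseMat] <;>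
    first
    | linear_combination (1/2) * h * (-1)
    | linear_combination (1/2) * h

lemma lower_eq (a b : Fin 2) :
    spinMat 0 a b - Complex.I * spinMat 1 a b = raiseMat b a := by
  have h := Complex.I_mul_I
  fin_cases a <;> fin_cases b <;> simp [spinMat, raiseMat] <;>
    first
    | linear_combination (1/2) * h * (-1)
    | linear_combination (1/2) * h

lemma plus_apply (N : ℕ) (f g : Fin N → Fin 2) :
    totalSpinPlus N f g = ∑ j, ∏ k, if k = j then raiseMat (f k) (g k) else
      (1 : Matrix (Fin 2) (Fin 2) ℂ) (f k) (g k) := by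
  unfold totalSpinPlus
  simp only [Matrix.add_apply, Matrix.smul_apply, totalSpin_apply, smul_eq_mul, Finset.mul_sum]
  rw [← Finset.sum_add_distrib]
  apply Finset.sum_congr rfl
  intro j _
  rw [prod_site (fun k => raiseMat (f k) (g k)), ← raise_eq]
  ring

lemma minus_eq (N : ℕ) : totalSpinMinus N = (totalSpinPlus N)ᵀ := by
  ext f g
  rw [Matrix.transpose_apply, plus_apply]
  unfold totalSpinMinus
  simp only [Matrix.sub_apply, Matrix.smul_apply, totalSpin_apply, smul_eq_mul, Finset.mul_sum]
  rw [← Finset.sum_sub_distrib]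
  apply Finset.sum_congr rfl
  intro j _
  rw [prod_site (fun k => raiseMat (g k) (f k)), ← lower_eq]
  have : ∀ k, (1 : Matrix (Fin 2) (Fin 2) ℂ) (g k) (f k)
      = (1 : Matrix (Fin 2) (Fin 2) ℂ) (f k) (g k) := by
    intro k
    simp [Matrix.one_apply, eq_comm]
  simp only [this]
  ring

open Polynomial in
lemma raise_gen (a b : Fin 2) :
    ∑ c, C (raiseMat a c) * genMat c b = derivative (genMat a b) := by
  fin_cases a <;> fin_cases b <;> simp [raiseMat, genMat]

open Polynomial in
lemma one_gen (a b : Fin 2) :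
    ∑ c, C ((1 : Matrix (Fin 2) (Fin 2) ℂ) a c) * genMat c b = genMat a b := by
  simp [Matrix.one_apply, apply_ite]

open Polynomial in
lemma plus_gen (N : ℕ) (f g : Fin N → Fin 2) :
    ∑ h, C (totalSpinPlus N f h) * genPoly N h g = derivative (genPoly N f g) := by
  have h1 : derivative (genPoly N f g) = ∑ j, ∏ k, ∑ c,
      C (if k = j then raiseMat (f k) c else (1 : Matrix (Fin 2) (Fin 2) ℂ) (f k) c)
        * genMat c (g k) := by
    unfold genPoly
    rw [derivative_prod_finset]
    apply Finset.sum_congr rfl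
    intro j _
    rw [← prod_site (fun k => derivative (genMat (f k) (g k)))]
    apply Finset.prod_congr rfl
    intro k _
    split_ifs
    · rw [raise_gen]
    · rw [one_gen]
  rw [h1]
  simp only [Fintype.prod_sum]
  rw [Finset.sum_comm]
  apply Finset.sum_congr rfl
  intro h _
  rw [plus_apply, map_sum, Finset.sum_mul]
  apply Finset.sum_congr rfl
  intro j _
  rw [map_prod, genPoly, Finset.prod_mul_distrib]

open Polynomial in
lemma plus_pow_apply (N m : ℕ) : ∀ (f g : Fin N → Fin 2),
    (totalSpinPlus N ^ m) f g = m.factorial * (genPoly N f g).coeff m := by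
  induction m with
  | zero =>
    intro f g
    simp only [pow_zero, Nat.factorial_zero, Nat.cast_one, one_mul, genPoly]
    rw [coeff_zero_prod, Matrix.one_apply]
    have h0 : ∀ a b : Fin 2, (genMat a b).coeff 0 = if a = b then 1 else 0 := by
      intro a b
      fin_cases a <;> fin_cases b <;> simp [genMat]
    simp only [h0]
    rw [Finset.prod_ite_zero]
    simp [funext_iff]
  | succ m ih =>
    intro f g
    rw [pow_succ', Matrix.mul_apply]
    simp only [ih]
    have h := congrArg (fun p => coeff p m) (plus_gen N f g)
    simp only [finsetSum_coeff, coeff_C_mul, coeff_derivative] at h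
    rw [Nat.factorial_succ]
    push_cast
    rw [show ((m : ℂ) + 1) * m.factorial * (genPoly N f g).coeff (m + 1) =
      m.factorial * ((genPoly N f g).coeff (m + 1) * (m + 1)) by ring, ← h, Finset.mul_sum]
    apply Finset.sum_congr rfl
    intro h _
    ring

open Polynomial in
lemma genPoly_form (N : ℕ) (f g : Fin N → Fin 2) :
    genPoly N f g = 0 ∨ ∃ d, genPoly N f g = X ^ d := by
  unfold genPoly
  apply Finset.prod_induction _ (fun p : Polynomial ℂ => p = 0 ∨ ∃ d, p = X ^ d)
  · rintro a b (rfl | ⟨d, rfl⟩) (rfl | ⟨e, rfl⟩)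
    · simp
    · simp
    · simp
    · exact Or.inr ⟨d + e, by rw [pow_add]⟩
  · exact Or.inr ⟨0, by simp⟩
  · intro k _
    unfold genMat
    split_ifs
    · exact Or.inr ⟨0, by simp⟩
    · exact Or.inr ⟨1, by simp⟩
    · exact Or.inl rfl

open Polynomial in
lemma coeff_mul_coeff (N m n : ℕ) (f g : Fin N → Fin 2) :
    (genPoly N f g).coeff m * (genPoly N f g).coeff n
      = if m = n then (genPoly N f g).coeff n else 0 := by
  rcases genPoly_form N f g with h | ⟨d, h⟩
  · simp [h]
  · rw [h]
    simp only [coeff_X_pow]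
    grind

open Polynomial in
lemma sum_genPoly (N : ℕ) : ∑ f, ∑ g, genPoly N f g = (X + C 2) ^ N := by
  unfold genPoly
  simp only [← Fintype.prod_sum]
  have : (∑ a : Fin 2, ∑ b : Fin 2, genMat a b) = X + C 2 := by
    have h2 : (C 2 : Polynomial ℂ) = 1 + 1 := by rw [← one_add_one_eq_two, C_add, C_1]
    rw [h2]
    simp [genMat]
    ring
  have h3 := (Fintype.prod_sum (fun (_ : Fin N) (a : Fin 2) => ∑ b, genMat a b)).symm
  rw [h3, ← this, Finset.prod_const]
  simp

lemma trace_eq_s15 (N m n : ℕ) :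
    (totalSpinPlus N ^ m * totalSpinMinus N ^ n).trace =
      if m = n then (n.factorial : ℂ) ^ 2 * (2 ^ (N - n) * (N.choose n : ℂ)) else 0 := by
  have h1 : (totalSpinPlus N ^ m * totalSpinMinus N ^ n).trace =
      m.factorial * n.factorial *
        ∑ f, ∑ g, if m = n then (genPoly N f g).coeff n else 0 := by
    rw [minus_eq, ← Matrix.transpose_pow]
    simp only [Matrix.trace, Matrix.diag_apply, Matrix.mul_apply, Matrix.transpose_apply,
      plus_pow_apply, Finset.mul_sum, ← coeff_mul_coeff]
    apply Finset.sum_congr rfl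
    intro f _
    apply Finset.sum_congr rfl
    intro g _
    ring
  rw [h1]
  split_ifs with h
  · subst h
    rw [← Polynomial.coeff_X_add_C_pow, ← sum_genPoly]
    simp only [Polynomial.finsetSum_coeff]
    ring
  · simp

lemma boson_sum (m n : ℕ) :
    ((2 / Real.sqrt 3) *
        ∑' k : ℕ, Real.exp (-Real.log 3 * ((k : ℝ) + 1 / 2)) * bosonMatrixElem m n k : ℝ)
      = (if m = n then (Nat.factorial n : ℝ) / 2 ^ n else 0) := by
  split_ifs with h
  · subst h
    have hs : Real.sqrt 3 ^ 2 = 3 := Real.sq_sqrt (by norm_num)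
    have hs0 : Real.sqrt 3 ≠ 0 := by positivity
    have he : ∀ k : ℕ, Real.exp (-Real.log 3 * ((k : ℝ) + 1 / 2)) = (1/3)^k * (Real.sqrt 3)⁻¹ := by
      intro k
      rw [show -Real.log 3 * ((k : ℝ) + 1 / 2) = k * (-Real.log 3) + -(Real.log 3 / 2) by ring,
        Real.exp_add, Real.exp_nat_mul, Real.exp_neg, Real.exp_neg, Real.exp_log (by norm_num),
        ← Real.log_sqrt (by norm_num), Real.exp_log (by positivity)]
      norm_num
    have hi := (add_left_injective m).tsum_eq
      (f := fun k : ℕ => Real.exp (-Real.log 3 * ((k : ℝ) + 1 / 2)) * bosonMatrixElem m m k) (by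
        intro k hk
        by_contra hc
        apply hk
        have : ¬ m ≤ k := fun hle => hc ⟨k - m, by simp; omega⟩
        simp [bosonMatrixElem, this])
    rw [← hi]
    have hterm : ∀ k : ℕ, Real.exp (-Real.log 3 * (((k + m : ℕ) : ℝ) + 1 / 2)) *
        bosonMatrixElem m m (k + m) =
        ((1/3)^m * (Real.sqrt 3)⁻¹ * m.factorial) * (((k + m).choose m : ℝ) * (1/3)^k) := by
      intro k
      rw [he]
      have hc := Nat.add_choose_mul_factorial_mul_factorial k m
      have hc' : (((k+m).choose m : ℕ) : ℝ) * k.factorial * m.factorial = (k+m).factorial := by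
        exact_mod_cast hc
      have hk0 : (k.factorial : ℝ) ≠ 0 := by exact_mod_cast k.factorial_ne_zero
      simp only [bosonMatrixElem, Nat.le_add_left, if_true, Nat.add_sub_cancel]
      rw [← hc']
      field_simp
      ring
    simp only [hterm]
    rw [tsum_mul_left, tsum_choose_mul_geometric_of_norm_lt_one m (by norm_num)]
    have h3 : (1 - 1/3 : ℝ) = 2/3 := by norm_num
    rw [h3]
    simp only [div_pow, one_pow, pow_succ]
    field_simp
    rw [hs]
  · have : ∀ k, bosonMatrixElem m n k = 0 := by
      intro k
      simp [bosonMatrixElem, h]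
    simp [this]

lemma choose_lim (n : ℕ) :
    Tendsto (fun N : ℕ => (N.choose n : ℝ) / (N : ℝ) ^ n) atTop (𝓝 (1 / n.factorial)) := by
  have h := (isEquivalent_choose n)
  have h2 := h.div (Asymptotics.IsEquivalent.refl (u := fun N : ℕ => (N : ℝ) ^ n) (l := atTop))
  refine h2.symm.tendsto_nhds ?_
  apply tendsto_const_nhds.congr'
  filter_upwards [eventually_gt_atTop 0] with N hN
  have : (N : ℝ) ≠ 0 := by positivity
  simp only [Pi.div_apply]
  field_simp

/-- monomial form of the main bosonization theorem: for all `m, n ∈ ℕ`,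
`lim_{N→∞} 2^{-N} N^{-(m+n)/2} tr((Ŝ_+^{(N)})^m (Ŝ_-^{(N)})^n)
  = (2/√3) Σ_k e^{-ln 3 (k+1/2)} ⟨k|(a†)^m a^n|k⟩`, and both sides equal `δ_{mn} n!/2^n`. -/
theorem bosonization_monomial (m n : ℕ) :
    Tendsto (fun N : ℕ =>
        (totalSpinPlus N ^ m * totalSpinMinus N ^ n).trace /
          (2 ^ N * ((Real.sqrt N : ℂ)) ^ (m + n)))
      atTop
      (𝓝 (((2 / Real.sqrt 3) *
        ∑' k : ℕ, Real.exp (-Real.log 3 * ((k : ℝ) + 1 / 2)) * bosonMatrixElem m n k : ℝ) : ℂ)) ∧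
    ((2 / Real.sqrt 3) *
        ∑' k : ℕ, Real.exp (-Real.log 3 * ((k : ℝ) + 1 / 2)) * bosonMatrixElem m n k : ℝ)
      = (if m = n then (Nat.factorial n : ℝ) / 2 ^ n else 0) := by
  refine ⟨?_, boson_sum m n⟩
  rw [boson_sum]
  simp only [trace_eq_s15]
  split_ifs with h
  · subst h
    have h1 := ((choose_lim m).const_mul ((m.factorial : ℝ) ^ 2 / 2 ^ m))
    have h2 := (Complex.continuous_ofReal.tendsto _).comp h1
    have hf : (m.factorial : ℝ) ≠ 0 := by exact_mod_cast m.factorial_ne_zero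
    have hl : (m.factorial : ℝ) ^ 2 / 2 ^ m * (1 / m.factorial) = m.factorial / 2 ^ m := by
      field_simp
    rw [hl] at h2
    refine h2.congr' ?_
    filter_upwards [eventually_ge_atTop m, eventually_gt_atTop 0] with N hN hN0
    have hs : ((Real.sqrt N : ℝ) : ℂ) ^ (m + m) = (N : ℂ) ^ m := by
      rw [← two_mul, pow_mul, ← Complex.ofReal_pow, Real.sq_sqrt (by positivity)]
      simp
    have hN' : (N : ℂ) ≠ 0 := by exact_mod_cast hN0.ne'
    have hp : (2 : ℂ) ^ N = 2 ^ (N - m) * 2 ^ m := by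
      rw [← pow_add, Nat.sub_add_cancel hN]
    rw [hs, hp]
    simp only [Function.comp]
    push_cast
    field_simp
  · simp
end
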